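/- arXiv:2306.16569 — 2 statements merged into one kernel-verified Lean document; each statement's English description precedes it below -/
import Mathlib

section
/- Let T, U > 0, C ≥ 0, and let γ : ℝ × ℝ → ℝ be twice continuously differentiable, periodic with period 2T in its first variable and period 2U in its second variable, and satisfy ∫₀^{2T} ∫₀^{2U} |∂²γ/∂t∂u(t,u)| du dt ≤ C. Then for all natural numbers K, L ≥ 1, ∑_{(k,l) ∈ ℤ², |k| > K, |l| > L} |c_{k,l}|² ≤ C² / (π⁴·K·L), where c_{k,l} = (1/(4TU)) ∫₀^{2U} ∫₀^{2T} γ(t,u) · exp(−iπkt/T) · exp(−iπlu/U) dt du. -/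
open MeasureTheory Real Complex

/-- Fubini for iterated interval integrals of a jointly continuous function. -/
theorem intervalIntegral_comm_of_continuous {E : Type*} [NormedAddCommGroup E] [NormedSpace ℝ E]
    {f : ℝ → ℝ → E} (hf : Continuous (Function.uncurry f)) {a b c d : ℝ} (hab : a ≤ b)
    (hcd : c ≤ d) :
    ∫ x in a..b, ∫ y in c..d, f x y = ∫ y in c..d, ∫ x in a..b, f x y := by
  simp only [intervalIntegral.integral_of_le hab, intervalIntegral.integral_of_le hcd]
  apply integral_integral_swap
  rw [Measure.prod_restrict, ← Measure.volume_eq_prod]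
  exact (hf.continuousOn.integrableOn_compact (isCompact_Icc.prod isCompact_Icc)).mono_set
    (Set.prod_mono Set.Ioc_subset_Icc_self Set.Ioc_subset_Icc_self)

/-- Integration by parts against an exponential of period `P`. -/
theorem integral_mul_cexp_eq_of_periodic {f : ℝ → ℝ} (hf : ContDiff ℝ 1 f) {P : ℝ}
    (hP : f P = f 0) {a : ℂ} (ha : a ≠ 0) (haP : cexp (a * P) = 1) :
    ∫ t in (0 : ℝ)..P, (f t : ℂ) * cexp (a * t)
      = -a⁻¹ * ∫ t in (0 : ℝ)..P, ((deriv f t : ℝ) : ℂ) * cexp (a * t) := by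
  have hu : ∀ x ∈ Set.uIcc 0 P, HasDerivAt (fun t : ℝ => (f t : ℂ)) ((deriv f x : ℝ) : ℂ) x :=
    fun x _ => ((hf.differentiable one_ne_zero x).hasDerivAt).ofReal_comp
  have hv : ∀ x ∈ Set.uIcc 0 P,
      HasDerivAt (fun t : ℝ => a⁻¹ * cexp (a * t)) (cexp (a * x)) x := by
    intro x _
    have h1 : HasDerivAt (fun t : ℝ => a * (t : ℂ)) a x := by
      simpa using (Complex.ofRealCLM.hasDerivAt (x := x)).const_mul a
    have h2 := h1.cexp.const_mul a⁻¹
    rwa [mul_comm _ a, inv_mul_cancel_left₀ ha] at h2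
  have hc : Continuous (deriv f) := hf.continuous_deriv le_rfl
  rw [intervalIntegral.integral_mul_deriv_eq_deriv_mul hu hv
    (Continuous.intervalIntegrable (by fun_prop) _ _)
    (Continuous.intervalIntegrable (by fun_prop) _ _)]
  simp only [haP, hP, mul_left_comm _ a⁻¹, intervalIntegral.integral_const_mul]
  simp

theorem contDiff_deriv_snd {f : ℝ → ℝ → ℝ} {n : ℕ}
    (hf : ContDiff ℝ (n + 1) (Function.uncurry f)) :
    ContDiff ℝ n (Function.uncurry fun t u => deriv (f t) u) := by
  have h : (Function.uncurry fun t u => deriv (f t) u)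
      = fun p => fderiv ℝ (Function.uncurry f) p (0, 1) := by
    ext ⟨t, u⟩
    have h1 := (hf.differentiable (by simp) (t, u)).hasFDerivAt
    have h2 : HasDerivAt (fun v : ℝ => (t, v)) ((0 : ℝ), (1 : ℝ)) u :=
      (hasDerivAt_const u t).prodMk (hasDerivAt_id u)
    exact (h1.comp_hasDerivAt u h2).deriv
  rw [h]
  exact (hf.fderiv_right le_rfl).clm_apply contDiff_const

theorem contDiff_deriv_fst {f : ℝ → ℝ → ℝ} {n : ℕ}
    (hf : ContDiff ℝ (n + 1) (Function.uncurry f)) :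
    ContDiff ℝ n (Function.uncurry fun t u => deriv (fun s => f s u) t) :=
  (contDiff_deriv_snd (f := fun u t => f t u) (hf.comp (contDiff_snd.prodMk contDiff_fst))).comp
    (contDiff_snd.prodMk contDiff_fst)

/-- Integrating by parts in both variables of a periodic function. -/
theorem integral_integral_mul_cexp_of_periodic {f : ℝ → ℝ → ℝ}
    (hf : ContDiff ℝ 2 (Function.uncurry f)) {P Q : ℝ} (hP : 0 ≤ P) (hQ : 0 ≤ Q)
    (hfP : ∀ u, Function.Periodic (fun t => f t u) P)
    (hfQ : ∀ t, Function.Periodic (f t) Q) {a b : ℂ} (ha : a ≠ 0) (hb : b ≠ 0)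
    (haP : cexp (a * P) = 1) (hbQ : cexp (b * Q) = 1) :
    ∫ u in (0 : ℝ)..Q, ∫ t in (0 : ℝ)..P, (f t u : ℂ) * cexp (a * t) * cexp (b * u)
      = a⁻¹ * b⁻¹ * ∫ t in (0 : ℝ)..P, ∫ u in (0 : ℝ)..Q,
          ((deriv (fun s => deriv (f s) u) t : ℝ) : ℂ) * cexp (a * t) * cexp (b * u) := by
  have hg : ContDiff ℝ 1 (Function.uncurry fun t u => deriv (f t) u) :=
    contDiff_deriv_snd (n := 1) (by simpa [one_add_one_eq_two] using hf)
  have hh : ContDiff ℝ 0 (Function.uncurry fun t u => deriv (fun s => deriv (f s) u) t) :=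
    contDiff_deriv_fst (n := 0) (f := fun t u => deriv (f t) u) (by simpa using hg)
  have cf : Continuous fun p : ℝ × ℝ => f p.1 p.2 := hf.continuous
  have cg : Continuous fun p : ℝ × ℝ => deriv (f p.1) p.2 := hg.continuous
  have ch : Continuous fun p : ℝ × ℝ => deriv (fun s => deriv (f s) p.2) p.1 := hh.continuous
  have cf' := cf.comp continuous_swap
  have cg' := cg.comp continuous_swap
  have ch' := ch.comp continuous_swap
  simp only [Function.comp_def, Prod.fst_swap, Prod.snd_swap] at cf' cg' ch'
  have hgP : ∀ u, deriv (f P) u = deriv (f 0) u := fun u => by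
    have : f P = f 0 := funext fun v => by simpa using hfP v 0
    rw [this]
  have hft : ∀ t, ContDiff ℝ 1 (f t) := fun t =>
    (hf.comp (contDiff_const.prodMk contDiff_id)).of_le one_le_two
  have hgu : ∀ u, ContDiff ℝ 1 fun t => deriv (f t) u := fun u =>
    hg.comp (contDiff_id.prodMk contDiff_const)
  calc _ = ∫ t in (0 : ℝ)..P, ∫ u in (0 : ℝ)..Q, (f t u : ℂ) * cexp (a * t) * cexp (b * u) :=
        intervalIntegral_comm_of_continuous (by unfold Function.uncurry; fun_prop) hQ hP
    _ = ∫ t in (0 : ℝ)..P, -b⁻¹ * ∫ u in (0 : ℝ)..Q,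
          ((deriv (f t) u : ℝ) : ℂ) * cexp (a * t) * cexp (b * u) := by
        congr 1 with t
        simp only [mul_right_comm _ (cexp (a * t)), intervalIntegral.integral_mul_const]
        rw [integral_mul_cexp_eq_of_periodic (hft t) (by simpa using hfQ t 0) hb hbQ, mul_assoc]
    _ = -b⁻¹ * ∫ u in (0 : ℝ)..Q, ∫ t in (0 : ℝ)..P,
          ((deriv (f t) u : ℝ) : ℂ) * cexp (a * t) * cexp (b * u) := by
        rw [intervalIntegral.integral_const_mul, intervalIntegral_comm_of_continuous
          (by unfold Function.uncurry; fun_prop) hP hQ]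
    _ = -b⁻¹ * ∫ u in (0 : ℝ)..Q, -a⁻¹ * ∫ t in (0 : ℝ)..P,
          ((deriv (fun s => deriv (f s) u) t : ℝ) : ℂ) * cexp (a * t) * cexp (b * u) := by
        congr 2 with u
        simp only [intervalIntegral.integral_mul_const]
        rw [integral_mul_cexp_eq_of_periodic (hgu u) (hgP u) ha haP, mul_assoc]
    _ = _ := by
        rw [intervalIntegral.integral_const_mul, intervalIntegral_comm_of_continuous
          (by unfold Function.uncurry; fun_prop) hQ hP]
        ring

theorem norm_integral_integral_le_of_continuous {E : Type*} [NormedAddCommGroup E]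
    [NormedSpace ℝ E] {f : ℝ → ℝ → E} (hf : Continuous (Function.uncurry f)) {a b c d : ℝ}
    (hab : a ≤ b) (hcd : c ≤ d) :
    ‖∫ x in a..b, ∫ y in c..d, f x y‖ ≤ ∫ x in a..b, ∫ y in c..d, ‖f x y‖ := by
  refine (intervalIntegral.norm_integral_le_integral_norm hab).trans
    (intervalIntegral.integral_mono_on hab ?_ ?_ fun x _ =>
      intervalIntegral.norm_integral_le_integral_norm hcd)
  · exact (intervalIntegral.continuous_parametric_intervalIntegral_of_continuous'
      hf c d).norm.intervalIntegrable _ _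
  · exact (intervalIntegral.continuous_parametric_intervalIntegral_of_continuous'
      (f := fun x y => ‖f x y‖) hf.norm c d).intervalIntegrable _ _

/-- The two-sided tail `∑_{|k| > K} k⁻²` converges and is at most `4 / K`. -/
theorem summable_and_tsum_int_inv_sq_tail_le {K : ℕ} (hK : 1 ≤ K) :
    (Summable fun k : ℤ => if (K : ℤ) < |k| then ((k : ℝ) ^ 2)⁻¹ else 0) ∧
      ∑' k : ℤ, (if (K : ℤ) < |k| then ((k : ℝ) ^ 2)⁻¹ else 0) ≤ 4 / K := by
  have hK0 : (0 : ℝ) < K := by exact_mod_cast hK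
  let g : ℕ → ℝ := fun n => if K < n then ((n : ℝ) ^ 2)⁻¹ else 0
  have hg0 : ∀ n, 0 ≤ g n := fun n => by dsimp only [g]; split_ifs <;> positivity
  have hgs : ∀ n, ∑ i ∈ Finset.range n, g i ≤ 2 / K := fun n => by
    have h : (Finset.range n).filter (K < ·) = Finset.Ioo K n := by
      ext i; simp [and_comm]
    rw [← Finset.sum_filter, h]
    exact (sum_Ioo_inv_sq_le K n).trans (by gcongr; linarith)
  have hgsum := (summable_of_sum_range_le hg0 hgs).hasSum
  have hle := Real.tsum_le_of_sum_range_le hg0 hgs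
  have hZ : HasSum (fun k : ℤ => if (K : ℤ) < |k| then ((k : ℝ) ^ 2)⁻¹ else 0)
      (∑' n, g n + ∑' n, g n - 0) := by
    have h := HasSum.of_nat_of_neg
      (f := fun k : ℤ => if (K : ℤ) < |k| then ((k : ℝ) ^ 2)⁻¹ else 0)
      (g := ∑' n, g n) (g' := ∑' n, g n) (by simpa [g] using hgsum) (by simpa [g] using hgsum)
    simpa using h
  refine ⟨hZ.summable, ?_⟩
  rw [hZ.tsum_eq]
  calc _ ≤ 2 / (K : ℝ) + 2 / K - 0 := by gcongr
    _ = 4 / K := by ring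

/-- Tail bound for double Fourier coefficients: if `γ(t,u)` is `C²`, `2T`-periodic in `t`,
`2U`-periodic in `u`, and `∫₀^{2T} ∫₀^{2U} |∂²γ/∂t∂u| ≤ C`, then for all `K, L ≥ 1`,
`∑_{|k|>K, |l|>L} |c_{k,l}|² ≤ C²/(π⁴ K L)`. -/
theorem double_fourier_coeff_tail_bound
    (T U C : ℝ) (hT : 0 < T) (hU : 0 < U) (hC : 0 ≤ C)
    (γ : ℝ → ℝ → ℝ)
    (hγ : ContDiff ℝ 2 (Function.uncurry γ))
    (hperT : ∀ u : ℝ, Function.Periodic (fun t => γ t u) (2 * T))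
    (hperU : ∀ t : ℝ, Function.Periodic (fun u => γ t u) (2 * U))
    (hvar : (∫ t in (0 : ℝ)..(2 * T), ∫ u in (0 : ℝ)..(2 * U),
        |deriv (fun t' => deriv (fun u' => γ t' u') u) t|) ≤ C)
    (c : ℤ → ℤ → ℂ)
    (hc : ∀ k l : ℤ, c k l = (1 / (4 * T * U) : ℂ) *
      ∫ u in (0 : ℝ)..(2 * U), ∫ t in (0 : ℝ)..(2 * T),
        (γ t u : ℂ) * Complex.exp (-(Complex.I * (Real.pi : ℂ) * (k : ℂ) * (t : ℂ)) / (T : ℂ))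
          * Complex.exp (-(Complex.I * (Real.pi : ℂ) * (l : ℂ) * (u : ℂ)) / (U : ℂ))) :
    ∀ K L : ℕ, 1 ≤ K → 1 ≤ L →
      (∑' p : {p : ℤ × ℤ // (K : ℤ) < |p.1| ∧ (L : ℤ) < |p.2|}, ‖c (p : ℤ × ℤ).1 (p : ℤ × ℤ).2‖ ^ 2)
        ≤ C ^ 2 / (Real.pi ^ 4 * (K : ℝ) * (L : ℝ)) := by
  intro K L hK hL
  have hK0 : (0 : ℝ) < K := by exact_mod_cast hK
  have hL0 : (0 : ℝ) < L := by exact_mod_cast hL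
  have hTc : (T : ℂ) ≠ 0 := by exact_mod_cast hT.ne'
  have hUc : (U : ℂ) ≠ 0 := by exact_mod_cast hU.ne'
  have hπc : (π : ℂ) ≠ 0 := by exact_mod_cast Real.pi_ne_zero
  have hexp : ∀ (V : ℝ) (m : ℤ), (V : ℂ) ≠ 0 →
      cexp (-(I * π * m) / V * ((2 * V : ℝ) : ℂ)) = 1 := fun V m hV => by
    rw [Complex.exp_eq_one_iff]
    refine ⟨-m, ?_⟩
    push_cast
    field_simp
  have hnorm : ∀ (V : ℝ) (m : ℤ) (t : ℝ), ‖cexp (-(I * π * m) / V * t)‖ = 1 := fun V m t => by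
    have : -(I * π * m) / V * t = ((-(π * m) / V * t : ℝ) : ℂ) * I := by push_cast; ring
    rw [this, Complex.norm_exp_ofReal_mul_I]
  have hg : ContDiff ℝ 1 (Function.uncurry fun t u => deriv (γ t) u) :=
    contDiff_deriv_snd (n := 1) (by simpa [one_add_one_eq_two] using hγ)
  have hh : Continuous fun p : ℝ × ℝ => deriv (fun s => deriv (γ s) p.2) p.1 :=
    (contDiff_deriv_fst (n := 0) (f := fun t u => deriv (γ t) u) (by simpa using hg)).continuous
  have hbound : ∀ k l : ℤ, k ≠ 0 → l ≠ 0 →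
      ‖c k l‖ ^ 2 ≤ C ^ 2 / (16 * π ^ 4) * (((k : ℝ) ^ 2)⁻¹ * ((l : ℝ) ^ 2)⁻¹) := by
    intro k l hk hl
    have hkc : (k : ℂ) ≠ 0 := by exact_mod_cast hk
    have hlc : (l : ℂ) ≠ 0 := by exact_mod_cast hl
    have key := integral_integral_mul_cexp_of_periodic hγ (P := 2 * T) (Q := 2 * U)
      (a := -(I * π * k) / T) (b := -(I * π * l) / U) (by positivity) (by positivity) hperT hperU
      (by simp [hkc, hTc, hπc]) (by simp [hlc, hUc, hπc]) (hexp T k hTc) (hexp U l hUc)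
    have hker : ∀ (V : ℝ) (m : ℤ) (t : ℝ),
        -(I * π * m * t) / V = -(I * π * m) / V * t := fun V m t => by ring
    have hnorm_le : ‖∫ t in (0 : ℝ)..(2 * T), ∫ u in (0 : ℝ)..(2 * U),
        ((deriv (fun s => deriv (γ s) u) t : ℝ) : ℂ) * cexp (-(I * π * k) / T * t)
          * cexp (-(I * π * l) / U * u)‖ ≤ C := by
      refine (norm_integral_integral_le_of_continuous (by unfold Function.uncurry; fun_prop)
        (by positivity) (by positivity)).trans ?_
      simpa only [norm_mul, hnorm, mul_one, Complex.norm_real, Real.norm_eq_abs] using hvar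
    have hc_eq := hc k l
    simp only [hker] at hc_eq
    rw [key, ← mul_assoc] at hc_eq
    have hcoef : (1 / (4 * T * U) : ℂ) * ((-(I * π * k) / T)⁻¹ * (-(I * π * l) / U)⁻¹)
        = ((-(4 * π ^ 2 * k * l)⁻¹ : ℝ) : ℂ) := by
      push_cast
      field_simp
      simp
    rw [hc_eq, hcoef, norm_mul, mul_pow, Complex.norm_real, Real.norm_eq_abs, sq_abs]
    calc _ ≤ (-(4 * π ^ 2 * k * l : ℝ)⁻¹) ^ 2 * C ^ 2 := by gcongr
      _ = _ := by
        field_simp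
        ring
  obtain ⟨sK, tK⟩ := summable_and_tsum_int_inv_sq_tail_le hK
  obtain ⟨sL, tL⟩ := summable_and_tsum_int_inv_sq_tail_le hL
  set F : ℤ → ℝ := fun k => if (K : ℤ) < |k| then ((k : ℝ) ^ 2)⁻¹ else 0 with hF
  set G : ℤ → ℝ := fun l => if (L : ℤ) < |l| then ((l : ℝ) ^ 2)⁻¹ else 0 with hG
  have hF0 : 0 ≤ F := fun k => by dsimp only [F, Pi.zero_apply]; split_ifs <;> positivity
  have hG0 : 0 ≤ G := fun l => by dsimp only [G, Pi.zero_apply]; split_ifs <;> positivity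
  have sFG := sK.mul_of_nonneg sL hF0 hG0
  have hFG0 : ∀ p : ℤ × ℤ, 0 ≤ F p.1 * G p.2 := fun p => mul_nonneg (hF0 _) (hG0 _)
  let S : Set (ℤ × ℤ) := {p | (K : ℤ) < |p.1| ∧ (L : ℤ) < |p.2|}
  have sS : Summable fun p : S => C ^ 2 / (16 * π ^ 4) * (F p.1.1 * G p.1.2) :=
    (sFG.subtype S).mul_left _
  have hle : ∀ p : S, ‖c p.1.1 p.1.2‖ ^ 2 ≤ C ^ 2 / (16 * π ^ 4) * (F p.1.1 * G p.1.2) := by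
    rintro ⟨⟨k, l⟩, hk, hl⟩
    simp only [hF, hG, if_pos hk, if_pos hl]
    exact hbound k l (abs_pos.mp (by dsimp only at hk; lia)) (abs_pos.mp (by dsimp only at hl; lia))
  calc _ ≤ ∑' p : S, C ^ 2 / (16 * π ^ 4) * (F p.1.1 * G p.1.2) :=
        (Summable.of_nonneg_of_le (fun _ => by positivity) hle sS).tsum_le_tsum hle sS
    _ = C ^ 2 / (16 * π ^ 4) * ∑' p : S, F p.1.1 * G p.1.2 := tsum_mul_left
    _ ≤ C ^ 2 / (16 * π ^ 4) * ∑' p : ℤ × ℤ, F p.1 * G p.2 := by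
        gcongr
        exact sFG.tsum_subtype_le _ S hFG0
    _ = C ^ 2 / (16 * π ^ 4) * ((∑' k, F k) * ∑' l, G l) := by
        rw [sK.tsum_mul_tsum sL sFG]
    _ ≤ C ^ 2 / (16 * π ^ 4) * (4 / K * (4 / L)) := by
        gcongr
    _ = _ := by
        field_simp
        norm_num
end

section
/- Let T > 0, r > 0, and let x₀, v₀, x_T, v_T ∈ ℝ. Set d = x_T − x₀ − T·v₀ and e = v_T − v₀, and define the control γ*(t) = ((6T − 12t)/T³)·d + ((6t − 2T)/T²)·e. Then for every twice continuously differentiable function x : ℝ → ℝ satisfying x(0) = x₀, x'(0) = v₀, x(T) = x_T, and x'(T) = v_T, the cost satisfies ∫₀^T r·(x''(t))² dt ≥ ∫₀^T r·(γ*(t))² dt; that is, γ* is the minimum-cost acceleration among all controls steering the double integrator ẋ₁ = x₂, ẋ₂ = γ from (x₀, v₀) to (x_T, v_T) in time T. -/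
open MeasureTheory intervalIntegral

/-- Integration by parts of an affine weight against a second derivative. -/
lemma integral_affine_mul_deriv_deriv {x : ℝ → ℝ} (hx : ContDiff ℝ 2 x) (a b s T : ℝ) :
    ∫ t in s..T, (a + b * t) * deriv (deriv x) t =
      ((a + b * T) * deriv x T - b * x T) - ((a + b * s) * deriv x s - b * x s) := by
  have hx' : ContDiff ℝ 1 (deriv x) := hx.deriv'
  have hu : Continuous (deriv (deriv x)) := hx'.continuous_deriv_one
  refine integral_eq_sub_of_hasDerivAt (f := fun t => (a + b * t) * deriv x t - b * x t)
    (fun t _ => ?_) (Continuous.intervalIntegrable (by fun_prop) _ _)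
  have h₁ : HasDerivAt x (deriv x t) t := (hx.differentiable (by norm_num) t).hasDerivAt
  have h₂ : HasDerivAt (deriv x) (deriv (deriv x) t) t :=
    (hx'.differentiable (by norm_num) t).hasDerivAt
  have h₃ : HasDerivAt (fun t : ℝ => a + b * t) b t := by
    simpa using ((hasDerivAt_id t).const_mul b).const_add a
  exact ((h₃.mul h₂).sub (h₁.const_mul b)).congr_deriv (by ring)

/-- The energy of an affine control. -/
lemma integral_affine_sq (a b T : ℝ) :
    ∫ t in (0 : ℝ)..T, (a + b * t) ^ 2 = a ^ 2 * T + a * b * T ^ 2 + b ^ 2 * T ^ 3 / 3 := by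
  have h (t : ℝ) : HasDerivAt
      (fun t : ℝ => a ^ 2 * t + a * b * t ^ 2 + b ^ 2 / 3 * t ^ 3) ((a + b * t) ^ 2) t :=
    ((((hasDerivAt_id t).const_mul (a ^ 2)).add ((hasDerivAt_pow 2 t).const_mul (a * b))).add
      ((hasDerivAt_pow 3 t).const_mul (b ^ 2 / 3))).congr_deriv (by norm_num; ring)
  rw [integral_eq_sub_of_hasDerivAt (fun t _ => h t)
    (Continuous.intervalIntegrable (by fun_prop) _ _)]
  ring

/-- A control orthogonal to its difference from `u` has at most the energy of `u`. -/
lemma integral_sq_le_of_integral_mul_eq {g u : ℝ → ℝ} (hg : Continuous g) (hu : Continuous u)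
    {s T : ℝ} (hT : s ≤ T) (h : ∫ t in s..T, g t * u t = ∫ t in s..T, g t ^ 2) :
    ∫ t in s..T, g t ^ 2 ≤ ∫ t in s..T, u t ^ 2 := by
  have hle : ∫ t in s..T, (2 * (g t * u t) - g t ^ 2) ≤ ∫ t in s..T, u t ^ 2 :=
    integral_mono_on hT (Continuous.intervalIntegrable (by fun_prop) _ _)
      (Continuous.intervalIntegrable (by fun_prop) _ _)
      (fun t _ => by nlinarith [sq_nonneg (u t - g t)])
  rw [intervalIntegral.integral_sub (Continuous.intervalIntegrable (by fun_prop) _ _)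
    (Continuous.intervalIntegrable (by fun_prop) _ _), intervalIntegral.integral_const_mul, h]
    at hle
  linarith

/-- Optimality of the classical minimum-energy control for the double integrator:
among all `C²` trajectories `x` steering `(x₀, v₀)` to `(x_T, v_T)` in time `T`,
the control `γ*(t) = ((6T − 12t)/T³)·d + ((6t − 2T)/T²)·e` (with `d = x_T − x₀ − T v₀`,
`e = v_T − v₀`) minimizes the cost `∫₀^T r·(x''(t))² dt`. -/
theorem double_integrator_min_energy
    (T r x₀ v₀ xT vT : ℝ) (hT : 0 < T) (hr : 0 < r)
    (d e : ℝ) (hd : d = xT - x₀ - T * v₀) (he : e = vT - v₀)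
    (γstar : ℝ → ℝ)
    (hγstar : ∀ t : ℝ, γstar t = ((6 * T - 12 * t) / T ^ 3) * d + ((6 * t - 2 * T) / T ^ 2) * e)
    (x : ℝ → ℝ) (hx : ContDiff ℝ 2 x)
    (hx0 : x 0 = x₀) (hv0 : deriv x 0 = v₀)
    (hxT : x T = xT) (hvT : deriv x T = vT) :
    (∫ t in (0 : ℝ)..T, r * (γstar t) ^ 2)
      ≤ ∫ t in (0 : ℝ)..T, r * (deriv (deriv x) t) ^ 2 := by
  obtain ⟨a, ha⟩ : ∃ a, a = 6 * d / T ^ 2 - 2 * e / T := ⟨_, rfl⟩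
  obtain ⟨b, hb⟩ : ∃ b, b = 6 * e / T ^ 2 - 12 * d / T ^ 3 := ⟨_, rfl⟩
  have hγ : γstar = fun t => a + b * t := by
    funext t
    rw [hγstar, ha, hb]
    field_simp
    ring
  have hu : Continuous (deriv (deriv x)) := (ContDiff.deriv' hx).continuous_deriv_one
  rw [intervalIntegral.integral_const_mul, intervalIntegral.integral_const_mul, hγ]
  refine mul_le_mul_of_nonneg_left
    (integral_sq_le_of_integral_mul_eq (by fun_prop) hu hT.le ?_) hr.le
  rw [integral_affine_mul_deriv_deriv hx, integral_affine_sq, hx0, hv0, hxT, hvT, ha, hb, hd, he]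
  field_simp
  ring
end
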